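/- Let Ω ⊂⊂ ℂⁿ be a pseudoconvex domain with smooth boundary and ρ a defining function of Ω. Let p ∈ ∂Ω, let U_p be a neighborhood of p in ℂⁿ, and let L be a smooth (1,0) tangent vector field on U_p with Lρ = 0 on U_p and L_ρ(L,L)(p) = 0. Fix η₂ ∈ (1,∞) and write N := N_ρ. If L_{ρ^{η₂}}(aL + bN, aL + bN) > 0 for all (a,b) ∈ ℂ² ∖ {(0,0)} at every point of (ℂⁿ ∖ cl(Ω)) ∩ U_p, then (1/(η₂−1))·|L_ρ(L,N)|²/‖∇ρ‖² − (1/2)·(N L_ρ(L,L))/‖∇ρ‖ ≤ 0 at p. -/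

import Mathlib

noncomputable section

open Complex Topology
open scoped ENNReal

/-- Wirtinger derivative `∂f/∂z_j`. -/
def dz {n : ℕ} (j : Fin n) (f : (Fin n → ℂ) → ℂ) (z : Fin n → ℂ) : ℂ :=
  (fderiv ℝ f z (Pi.single j 1) - Complex.I * fderiv ℝ f z (Pi.single j Complex.I)) / 2

/-- Wirtinger derivative `∂f/∂z̄_j`. -/
def dzbar {n : ℕ} (j : Fin n) (f : (Fin n → ℂ) → ℂ) (z : Fin n → ℂ) : ℂ :=
  (fderiv ℝ f z (Pi.single j 1) + Complex.I * fderiv ℝ f z (Pi.single j Complex.I)) / 2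

/-- Complexification of a real-valued function. -/
def cplx {n : ℕ} (ρ : (Fin n → ℂ) → ℝ) : (Fin n → ℂ) → ℂ := fun z => (ρ z : ℂ)

/-- The Levi form `L_ρ(X,Y)(z) = Σ_{j,k} ∂²ρ/∂z_j∂z̄_k (z) X_j conj(Y_k)`. -/
def levi {n : ℕ} (ρ : (Fin n → ℂ) → ℝ) (X Y : Fin n → ℂ) (z : Fin n → ℂ) : ℂ :=
  ∑ j, ∑ k, dz j (fun w => dzbar k (cplx ρ) w) z * X j * (starRingEnd ℂ) (Y k)

/-- `Xf = Σ_j X_j ∂f/∂z_j` for a (1,0) vector `X`. -/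
def dirDeriv {n : ℕ} (X : Fin n → ℂ) (f : (Fin n → ℂ) → ℂ) (z : Fin n → ℂ) : ℂ :=
  ∑ j, X j * dz j f z

/-- `X̄f = Σ_j conj(X_j) ∂f/∂z̄_j`. -/
def dirDerivBar {n : ℕ} (X : Fin n → ℂ) (f : (Fin n → ℂ) → ℂ) (z : Fin n → ℂ) : ℂ :=
  ∑ j, (starRingEnd ℂ) (X j) * dzbar j f z

/-- Derivative of `f` along the (1,0) vector field `X`. -/
def fieldDeriv {n : ℕ} (X : (Fin n → ℂ) → (Fin n → ℂ)) (f : (Fin n → ℂ) → ℂ)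
    (z : Fin n → ℂ) : ℂ :=
  dirDeriv (X z) f z

/-- Euclidean norm of the real gradient of `ρ`. -/
def gradNorm {n : ℕ} (ρ : (Fin n → ℂ) → ℝ) (z : Fin n → ℂ) : ℝ :=
  Real.sqrt (∑ j, ((fderiv ℝ ρ z (Pi.single j 1)) ^ 2 +
    (fderiv ℝ ρ z (Pi.single j Complex.I)) ^ 2))

/-- The complex normal field `N_ρ`. -/
def nfield {n : ℕ} (ρ : (Fin n → ℂ) → ℝ) (z : Fin n → ℂ) : Fin n → ℂ := fun j =>
  ((Real.sqrt (∑ k, Complex.normSq (dz k (cplx ρ) z)) : ℝ) : ℂ)⁻¹ * dzbar j (cplx ρ) z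

/-- Squared Euclidean norm of a vector in ℂⁿ. -/
def enormSq {n : ℕ} (X : Fin n → ℂ) : ℝ := ∑ j, Complex.normSq (X j)

/-- `f` is strictly plurisubharmonic on `S`. -/
def StrictPSHOn {n : ℕ} (f : (Fin n → ℂ) → ℝ) (S : Set (Fin n → ℂ)) : Prop :=
  ∀ z ∈ S, ∀ X : Fin n → ℂ, X ≠ 0 → 0 < (levi f X X z).re

/-- `ρ` is a (global smooth) defining function of `Ω` on the neighborhood `V` of `cl Ω`. -/
structure IsDefFn {n : ℕ} (Ω V : Set (Fin n → ℂ)) (ρ : (Fin n → ℂ) → ℝ) : Prop where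
  isOpen : IsOpen V
  subset : closure Ω ⊆ V
  smooth : ContDiffOn ℝ (⊤ : ℕ∞) ρ V
  eq : Ω = {z ∈ V | ρ z < 0}
  grad_ne : ∀ z ∈ frontier Ω, fderiv ℝ ρ z ≠ 0

/-- The Levi form of `ρ` is positive semidefinite on complex tangent vectors at `z`. -/
def LeviPseudoconvexAt {n : ℕ} (ρ : (Fin n → ℂ) → ℝ) (z : Fin n → ℂ) : Prop :=
  ∀ X : Fin n → ℂ, dirDeriv X (cplx ρ) z = 0 → 0 ≤ (levi ρ X X z).re

/-- `Ω` is a (smoothly bounded, Levi) pseudoconvex domain. -/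
def IsPseudoconvex {n : ℕ} (Ω : Set (Fin n → ℂ)) : Prop :=
  ∃ (V : Set (Fin n → ℂ)) (ρ : (Fin n → ℂ) → ℝ), IsDefFn Ω V ρ ∧
    ∀ p ∈ frontier Ω, LeviPseudoconvexAt ρ p

/-- The set of Steinness exponents of `ρ`. -/
def steinExpSet {n : ℕ} (Ω : Set (Fin n → ℂ)) (ρ : (Fin n → ℂ) → ℝ) : Set ℝ :=
  {η : ℝ | 1 < η ∧ ∃ W : Set (Fin n → ℂ), IsOpen W ∧ frontier Ω ⊆ W ∧
    StrictPSHOn (fun z => ρ z ^ η) ((closure Ω)ᶜ ∩ W)}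

/-- The Steinness exponent `η̃_ρ` of a defining function `ρ` (`∞` if none exists). -/
def steinExp {n : ℕ} (Ω : Set (Fin n → ℂ)) (ρ : (Fin n → ℂ) → ℝ) : ℝ≥0∞ :=
  sInf (ENNReal.ofReal '' steinExpSet Ω ρ)

/-- The Steinness index `S(Ω)`. -/
def steinIndex {n : ℕ} (Ω : Set (Fin n → ℂ)) : ℝ≥0∞ :=
  ⨅ (V : Set (Fin n → ℂ)) (ρ : (Fin n → ℂ) → ℝ) (_ : IsDefFn Ω V ρ), steinExp Ω ρ

/-- The set of Diederich–Fornæss exponents of `ρ`. -/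
def dfExpSet {n : ℕ} (Ω : Set (Fin n → ℂ)) (ρ : (Fin n → ℂ) → ℝ) : Set ℝ :=
  {η : ℝ | 0 < η ∧ η < 1 ∧ StrictPSHOn (fun z => -((-ρ z) ^ η)) Ω}

/-- The Diederich–Fornæss exponent of `ρ` (`0` if no exponent exists). -/
def dfExp {n : ℕ} (Ω : Set (Fin n → ℂ)) (ρ : (Fin n → ℂ) → ℝ) : ℝ :=
  sSup (insert 0 (dfExpSet Ω ρ))

/-- The Diederich–Fornæss index `DF(Ω)`. -/
def dfIndex {n : ℕ} (Ω : Set (Fin n → ℂ)) : ℝ :=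
  sSup {t : ℝ | ∃ V ρ, IsDefFn Ω V ρ ∧ t = dfExp Ω ρ}

/-- `L` is a smooth (1,0) tangent vector field for `ρ` on `A`. -/
def IsTangentField {n : ℕ} (ρ : (Fin n → ℂ) → ℝ) (L : (Fin n → ℂ) → (Fin n → ℂ))
    (A : Set (Fin n → ℂ)) : Prop :=
  ContDiffOn ℝ (⊤ : ℕ∞) L A ∧ ∀ z ∈ A, dirDeriv (L z) (cplx ρ) z = 0

/-- The key differential inequality
`(1/(η₂−1))|L_ρ(L,N)|²/‖∇ρ‖² − (1/2)(N L_ρ(L,L))/‖∇ρ‖ ≤ 0` at `p`. -/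
def keyIneqAt {n : ℕ} (ρ : (Fin n → ℂ) → ℝ) (L : (Fin n → ℂ) → (Fin n → ℂ)) (η₂ : ℝ)
    (p : Fin n → ℂ) : Prop :=
  1 / (η₂ - 1) * Complex.normSq (levi ρ (L p) (nfield ρ p) p) / (gradNorm ρ p) ^ 2 -
    1 / 2 * (fieldDeriv (nfield ρ) (fun w => levi ρ (L w) (L w) w) p).re / gradNorm ρ p ≤ 0

/-- The strict version of the key differential inequality. -/
def strictKeyIneqAt {n : ℕ} (ρ : (Fin n → ℂ) → ℝ) (L : (Fin n → ℂ) → (Fin n → ℂ)) (η₂ : ℝ)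
    (p : Fin n → ℂ) : Prop :=
  1 / (η₂ - 1) * Complex.normSq (levi ρ (L p) (nfield ρ p) p) / (gradNorm ρ p) ^ 2 -
    1 / 2 * (fieldDeriv (nfield ρ) (fun w => levi ρ (L w) (L w) w) p).re / gradNorm ρ p < 0

/-- `cl Ω` has a strong Stein neighborhood basis. -/
def HasStrongSteinBasis {n : ℕ} (Ω : Set (Fin n → ℂ)) : Prop :=
  ∃ (V : Set (Fin n → ℂ)) (ρ : (Fin n → ℂ) → ℝ), IsDefFn Ω V ρ ∧ ∃ ε₀ : ℝ, 0 < ε₀ ∧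
    (∀ z ∈ V, 0 ≤ ρ z → ρ z < ε₀ → fderiv ℝ ρ z ≠ 0) ∧
    ∀ ε : ℝ, 0 ≤ ε → ε < ε₀ → ∀ z ∈ V, ρ z = ε → LeviPseudoconvexAt ρ z

/-- Vanishing order at `0` of a holomorphic function `ℂ → ℂ` (`∞` if all derivatives vanish). -/
def orderC (h : ℂ → ℂ) : ℕ∞ :=
  sInf ((fun k : ℕ => (k : ℕ∞)) '' {k : ℕ | iteratedDeriv k h 0 ≠ 0})

/-- Vanishing order at `0` of a real-valued function on `ℂ`. -/
def orderR (g : ℂ → ℝ) : ℕ∞ :=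
  sInf ((fun k : ℕ => (k : ℕ∞)) '' {k : ℕ | iteratedFDeriv ℝ k g 0 ≠ 0})

/-- `ν(γ)`: minimal vanishing order at `0` of the components of `γ − p`. -/
def curveOrder {n : ℕ} (γ : ℂ → Fin n → ℂ) (p : Fin n → ℂ) : ℕ∞ :=
  ⨅ j, orderC (fun t => γ t j - p j)

/-- `p` is a boundary point of finite D'Angelo 1-type (w.r.t. the defining function `ρ`). -/
def FiniteTypePt {n : ℕ} (ρ : (Fin n → ℂ) → ℝ) (p : Fin n → ℂ) : Prop :=
  ∃ M : ℕ, ∀ γ : ℂ → Fin n → ℂ, (∀ j, AnalyticAt ℂ (fun t => γ t j) 0) → γ 0 = p →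
    ¬ (∀ᶠ t in nhds (0 : ℂ), γ t = p) →
    orderR (fun t => ρ (γ t)) ≤ (M : ℕ∞) * curveOrder γ p

section Wirtinger

variable {n : ℕ} {f g : (Fin n → ℂ) → ℂ} {ρ : (Fin n → ℂ) → ℝ} {z : Fin n → ℂ}

lemma hasFDerivAt_cplx (hρ : DifferentiableAt ℝ ρ z) :
    HasFDerivAt (cplx ρ) (Complex.ofRealCLM.comp (fderiv ℝ ρ z)) z :=
  Complex.ofRealCLM.hasFDerivAt.comp z hρ.hasFDerivAt

lemma contDiffAt_cplx {m : WithTop ℕ∞} (hρ : ContDiffAt ℝ m ρ z) :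
    ContDiffAt ℝ m (cplx ρ) z :=
  Complex.ofRealCLM.contDiff.contDiffAt.comp z hρ

lemma dz_cplx (hρ : DifferentiableAt ℝ ρ z) (j : Fin n) :
    dz j (cplx ρ) z =
      (fderiv ℝ ρ z (Pi.single j 1) - I * fderiv ℝ ρ z (Pi.single j I)) / 2 := by
  simp [dz, (hasFDerivAt_cplx hρ).fderiv]

lemma dzbar_cplx (hρ : DifferentiableAt ℝ ρ z) (j : Fin n) :
    dzbar j (cplx ρ) z =
      (fderiv ℝ ρ z (Pi.single j 1) + I * fderiv ℝ ρ z (Pi.single j I)) / 2 := by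
  simp [dzbar, (hasFDerivAt_cplx hρ).fderiv]

lemma dzbar_cplx_eq_conj (hρ : DifferentiableAt ℝ ρ z) (j : Fin n) :
    dzbar j (cplx ρ) z = (starRingEnd ℂ) (dz j (cplx ρ) z) := by
  simp [dz_cplx hρ, dzbar_cplx hρ, map_div₀, map_ofNat]

lemma dz_congr (h : f =ᶠ[𝓝 z] g) (j : Fin n) : dz j f z = dz j g z := by
  simp [dz, h.fderiv_eq]

lemma dz_mul (hf : DifferentiableAt ℝ f z) (hg : DifferentiableAt ℝ g z) (j : Fin n) :
    dz j (fun w => f w * g w) z = f z * dz j g z + dz j f z * g z := by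
  have := (hf.hasFDerivAt.mul hg.hasFDerivAt).fderiv
  simp only [Pi.mul_def] at this
  simp only [dz, this, add_apply, smul_apply, smul_eq_mul]
  ring

lemma contDiffAt_dz {m k : WithTop ℕ∞} (hf : ContDiffAt ℝ m f z) (hk : k + 1 ≤ m) (j : Fin n) :
    ContDiffAt ℝ k (dz j f) z := by
  have h := hf.fderiv_right hk
  unfold dz
  fun_prop

lemma contDiffAt_dzbar {m k : WithTop ℕ∞} (hf : ContDiffAt ℝ m f z) (hk : k + 1 ≤ m)
    (j : Fin n) : ContDiffAt ℝ k (dzbar j f) z := by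
  have h := hf.fderiv_right hk
  unfold dzbar
  fun_prop

lemma fderiv_cplx_comp {φ : ℝ → ℝ} {φ' : ℝ} (hρ : DifferentiableAt ℝ ρ z)
    (hφ : HasDerivAt φ φ' (ρ z)) :
    fderiv ℝ (cplx fun w => φ (ρ w)) z = φ' • fderiv ℝ (cplx ρ) z := by
  have h := hφ.comp_hasFDerivAt z hρ.hasFDerivAt
  have h1 : fderiv ℝ (cplx fun w => φ (ρ w)) z = _ :=
    (hasFDerivAt_cplx h.differentiableAt).fderiv
  have h2 : fderiv ℝ (fun w => φ (ρ w)) z = _ := h.fderiv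
  rw [h1, (hasFDerivAt_cplx hρ).fderiv]
  ext v
  change ((fderiv ℝ (fun w => φ (ρ w)) z v : ℝ) : ℂ) = _
  rw [h2]
  simp

lemma dz_cplx_comp {φ : ℝ → ℝ} {φ' : ℝ} (hρ : DifferentiableAt ℝ ρ z)
    (hφ : HasDerivAt φ φ' (ρ z)) (j : Fin n) :
    dz j (cplx fun w => φ (ρ w)) z = φ' * dz j (cplx ρ) z := by
  simp only [dz, fderiv_cplx_comp hρ hφ, smul_apply, Complex.real_smul]
  ring

lemma dzbar_cplx_comp {φ : ℝ → ℝ} {φ' : ℝ} (hρ : DifferentiableAt ℝ ρ z)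
    (hφ : HasDerivAt φ φ' (ρ z)) (j : Fin n) :
    dzbar j (cplx fun w => φ (ρ w)) z = φ' * dzbar j (cplx ρ) z := by
  simp only [dzbar, fderiv_cplx_comp hρ hφ, smul_apply, Complex.real_smul]
  ring

/-- The real directional derivative of a real function is `2 Re` of its `(1,0)` derivative. -/
lemma fderiv_eq_two_mul_re_dirDeriv (hρ : DifferentiableAt ℝ ρ z) (v : Fin n → ℂ) :
    fderiv ℝ ρ z v = 2 * (dirDeriv v (cplx ρ) z).re := by
  have hv : v = ∑ j, ((v j).re • (Pi.single j 1 : Fin n → ℂ) +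
      (v j).im • (Pi.single j I : Fin n → ℂ)) := by
    ext i
    simp [Finset.sum_apply, Pi.single_apply, Finset.sum_add_distrib, Complex.re_add_im]
  conv_lhs => rw [hv]
  simp only [map_sum, map_add, map_smul, smul_eq_mul, dirDeriv, Complex.re_sum, Finset.mul_sum]
  refine Finset.sum_congr rfl fun j _ => ?_
  rw [dz_cplx hρ]
  simp
  ring

lemma levi_add_left (X Y Z : Fin n → ℂ) :
    levi ρ (X + Y) Z z = levi ρ X Z z + levi ρ Y Z z := by
  simp only [levi, Pi.add_apply, mul_add, add_mul, Finset.sum_add_distrib]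

lemma levi_add_right (X Y Z : Fin n → ℂ) :
    levi ρ X (Y + Z) z = levi ρ X Y z + levi ρ X Z z := by
  simp only [levi, Pi.add_apply, map_add, mul_add, Finset.sum_add_distrib]

lemma levi_smul_left (b : ℂ) (X Y : Fin n → ℂ) :
    levi ρ (b • X) Y z = b * levi ρ X Y z := by
  simp only [levi, Pi.smul_apply, smul_eq_mul, Finset.mul_sum]
  exact Finset.sum_congr rfl fun j _ => Finset.sum_congr rfl fun k _ => by ring

lemma levi_smul_right (b : ℂ) (X Y : Fin n → ℂ) :
    levi ρ X (b • Y) z = (starRingEnd ℂ) b * levi ρ X Y z := by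
  simp only [levi, Pi.smul_apply, smul_eq_mul, Finset.mul_sum, map_mul]
  exact Finset.sum_congr rfl fun j _ => Finset.sum_congr rfl fun k _ => by ring

lemma dirDeriv_add (X Y : Fin n → ℂ) :
    dirDeriv (X + Y) f z = dirDeriv X f z + dirDeriv Y f z := by
  simp only [dirDeriv, Pi.add_apply, add_mul, Finset.sum_add_distrib]

lemma dirDeriv_smul (b : ℂ) (X : Fin n → ℂ) :
    dirDeriv (b • X) f z = b * dirDeriv X f z := by
  simp only [dirDeriv, Pi.smul_apply, smul_eq_mul, Finset.mul_sum, mul_assoc]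

lemma dz_dzbar_cplx (hρ : ContDiffAt ℝ 2 ρ z) (j k : Fin n) :
    dz j (fun w => dzbar k (cplx ρ) w) z =
      ((fderiv ℝ (fderiv ℝ ρ) z (Pi.single j 1) (Pi.single k 1) +
        fderiv ℝ (fderiv ℝ ρ) z (Pi.single j I) (Pi.single k I) : ℝ) +
      I * (fderiv ℝ (fderiv ℝ ρ) z (Pi.single j 1) (Pi.single k I) -
        fderiv ℝ (fderiv ℝ ρ) z (Pi.single j I) (Pi.single k 1) : ℝ)) / 4 := by
  have hev : (fun w => dzbar k (cplx ρ) w) =ᶠ[𝓝 z] fun w =>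
      ((fderiv ℝ ρ w (Pi.single k 1) : ℂ) + I * (fderiv ℝ ρ w (Pi.single k I) : ℂ)) / 2 := by
    filter_upwards [hρ.eventually (by simp)] with w hw
    exact dzbar_cplx (hw.differentiableAt (by simp)) k
  have hd : HasFDerivAt (fderiv ℝ ρ) (fderiv ℝ (fderiv ℝ ρ) z) z :=
    ((hρ.fderiv_right (m := 1) (by norm_num)).differentiableAt (by simp)).hasFDerivAt
  have happ (v : Fin n → ℂ) := Complex.ofRealCLM.hasFDerivAt.comp z
    (hd.clm_apply (hasFDerivAt_const v z))
  have hfd := (((happ (Pi.single k 1)).add ((happ (Pi.single k I)).const_mul I)).mul_const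
    ((2 : ℂ)⁻¹)).fderiv
  rw [dz_congr hev]
  simp only [div_eq_mul_inv, dz]
  erw [hfd]
  simp
  linear_combination (-(1 : ℂ) / 4) * (fderiv ℝ (fderiv ℝ ρ) z (Pi.single j I) (Pi.single k I)) *
    Complex.I_sq

lemma levi_conj_symm (hρ : ContDiffAt ℝ 2 ρ z) (X Y : Fin n → ℂ) :
    (starRingEnd ℂ) (levi ρ X Y z) = levi ρ Y X z := by
  have hs : IsSymmSndFDerivAt ℝ ρ z := hρ.isSymmSndFDerivAt (by simp)
  simp only [levi, map_sum]
  rw [Finset.sum_comm]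
  refine Finset.sum_congr rfl fun j _ => Finset.sum_congr rfl fun k _ => ?_
  rw [dz_dzbar_cplx hρ, dz_dzbar_cplx hρ, hs.eq (Pi.single j 1) (Pi.single k 1),
    hs.eq (Pi.single j I) (Pi.single k I), hs.eq (Pi.single j 1) (Pi.single k I),
    hs.eq (Pi.single j I) (Pi.single k 1)]
  simp [map_div₀, map_ofNat]
  ring

lemma levi_self_im (hρ : ContDiffAt ℝ 2 ρ z) (X : Fin n → ℂ) : (levi ρ X X z).im = 0 :=
  Complex.conj_eq_iff_im.1 (levi_conj_symm hρ X X)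

lemma re_levi_add_smul (hρ : ContDiffAt ℝ 2 ρ z) (X Y : Fin n → ℂ) (b : ℂ) :
    (levi ρ (X + b • Y) (X + b • Y) z).re = (levi ρ X X z).re +
      2 * ((starRingEnd ℂ) b * levi ρ X Y z).re + normSq b * (levi ρ Y Y z).re := by
  rw [levi_add_left, levi_add_right, levi_add_right, levi_smul_left, levi_smul_right,
    levi_smul_left, levi_smul_right, ← levi_conj_symm hρ X Y]
  simp [Complex.normSq_apply]
  ring

lemma levi_rpow (hρ : ContDiffAt ℝ 2 ρ z) (hz : 0 < ρ z) (η : ℝ) (X : Fin n → ℂ) :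
    levi (fun w => ρ w ^ η) X X z = ((η * ρ z ^ (η - 1) : ℝ) : ℂ) *
      (levi ρ X X z + ((η - 1) / ρ z : ℝ) * (normSq (dirDeriv X (cplx ρ) z) : ℝ)) := by
  have hρ1 : DifferentiableAt ℝ ρ z := hρ.differentiableAt (by simp)
  have hpow : ρ z ^ (η - 1 - 1) = ρ z ^ (η - 1) / ρ z := Real.rpow_sub_one hz.ne' _
  have hc : HasDerivAt (fun t : ℝ => η * t ^ (η - 1)) (η * ((η - 1) * ρ z ^ (η - 1 - 1))) (ρ z) :=
    (Real.hasDerivAt_rpow_const (Or.inl hz.ne')).const_mul η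
  have hsec (j k : Fin n) : dz j (fun w => dzbar k (cplx fun w => ρ w ^ η) w) z =
      ((η * ρ z ^ (η - 1) : ℝ) : ℂ) * (dz j (fun w => dzbar k (cplx ρ) w) z +
        ((η - 1) / ρ z : ℝ) * dz j (cplx ρ) z * (starRingEnd ℂ) (dz k (cplx ρ) z)) := by
    have hev : (fun w => dzbar k (cplx fun w => ρ w ^ η) w) =ᶠ[𝓝 z]
        fun w => cplx (fun w => η * ρ w ^ (η - 1)) w * dzbar k (cplx ρ) w := by
      filter_upwards [hρ.eventually (by simp),
        hρ.continuousAt.eventually (lt_mem_nhds hz)] with w hw hw0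
      exact dzbar_cplx_comp (hw.differentiableAt (by simp))
        (Real.hasDerivAt_rpow_const (Or.inl hw0.ne')) k
    have hcd : DifferentiableAt ℝ (fun w => η * ρ w ^ (η - 1)) z :=
      (hc.comp_hasFDerivAt z hρ1.hasFDerivAt).differentiableAt
    rw [dz_congr hev, dz_mul (hasFDerivAt_cplx hcd).differentiableAt
      ((contDiffAt_dzbar (k := 1) (contDiffAt_cplx hρ) (by norm_num) k).differentiableAt
        (by simp)), dz_cplx_comp hρ1 hc, dzbar_cplx_eq_conj hρ1, hpow]
    simp only [cplx]
    push_cast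
    ring
  have hsq : ((normSq (dirDeriv X (cplx ρ) z) : ℝ) : ℂ) =
      ∑ j, ∑ k, dz j (cplx ρ) z * (starRingEnd ℂ) (dz k (cplx ρ) z) * X j *
        (starRingEnd ℂ) (X k) := by
    rw [Complex.normSq_eq_conj_mul_self, mul_comm]
    simp only [dirDeriv, map_sum, map_mul, Finset.sum_mul_sum]
    exact Finset.sum_congr rfl fun j _ => Finset.sum_congr rfl fun k _ => by ring
  rw [hsq]
  simp only [levi, hsec, Finset.mul_sum, ← Finset.sum_add_distrib]
  exact Finset.sum_congr rfl fun j _ => Finset.sum_congr rfl fun k _ => by ring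

lemma gradNorm_eq (hρ : DifferentiableAt ℝ ρ z) :
    gradNorm ρ z = 2 * Real.sqrt (∑ k, normSq (dz k (cplx ρ) z)) := by
  have h : ∑ j, ((fderiv ℝ ρ z (Pi.single j 1)) ^ 2 + (fderiv ℝ ρ z (Pi.single j I)) ^ 2) =
      2 ^ 2 * ∑ k, normSq (dz k (cplx ρ) z) := by
    rw [Finset.mul_sum]
    refine Finset.sum_congr rfl fun j _ => ?_
    rw [dz_cplx hρ]
    simp [Complex.normSq_apply]
    ring
  rw [gradNorm, h, Real.sqrt_mul (by norm_num), Real.sqrt_sq (by norm_num)]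

lemma dirDeriv_nfield (hρ : DifferentiableAt ℝ ρ z) :
    dirDeriv (nfield ρ z) (cplx ρ) z = ((gradNorm ρ z / 2 : ℝ) : ℂ) := by
  have hS : 0 ≤ ∑ k, normSq (dz k (cplx ρ) z) := Finset.sum_nonneg fun k _ => normSq_nonneg _
  have h : ∑ j, dzbar j (cplx ρ) z * dz j (cplx ρ) z =
      ((∑ k, normSq (dz k (cplx ρ) z) : ℝ) : ℂ) := by
    push_cast
    refine Finset.sum_congr rfl fun j _ => ?_
    rw [dzbar_cplx_eq_conj hρ, Complex.normSq_eq_conj_mul_self]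
  rw [gradNorm_eq hρ, mul_div_cancel_left₀ _ two_ne_zero]
  simp only [dirDeriv, nfield, mul_assoc, ← Finset.mul_sum, h]
  rw [← Complex.ofReal_inv, ← Complex.ofReal_mul, inv_mul_eq_div, Real.div_sqrt]

lemma gradNorm_pos (hρ : DifferentiableAt ℝ ρ z) (h : fderiv ℝ ρ z ≠ 0) : 0 < gradNorm ρ z := by
  have hnn : 0 ≤ ∑ k, normSq (dz k (cplx ρ) z) := Finset.sum_nonneg fun k _ => normSq_nonneg _
  rw [gradNorm_eq hρ]
  refine mul_pos two_pos (Real.sqrt_pos.2 (lt_of_le_of_ne hnn fun h0 => h ?_))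
  have hk := (Finset.sum_eq_zero_iff_of_nonneg fun k _ => normSq_nonneg _).1 h0.symm
  ext v
  rw [fderiv_eq_two_mul_re_dirDeriv hρ]
  simp [dirDeriv, fun k => Complex.normSq_eq_zero.1 (hk k (Finset.mem_univ k))]

lemma continuousAt_dz_cplx (hρ : ContDiffAt ℝ 1 ρ z) (j : Fin n) :
    ContinuousAt (fun w => dz j (cplx ρ) w) z :=
  (contDiffAt_dz (k := 0) (contDiffAt_cplx hρ) (by norm_num) j).continuousAt

lemma continuousAt_gradNorm (hρ : ContDiffAt ℝ 1 ρ z) : ContinuousAt (gradNorm ρ) z := by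
  have h : ContinuousAt (fderiv ℝ ρ) z :=
    (hρ.fderiv_right (m := 0) (by norm_num)).continuousAt
  unfold gradNorm
  fun_prop

lemma continuousAt_nfield (hρ : ContDiffAt ℝ 1 ρ z) (h : fderiv ℝ ρ z ≠ 0) :
    ContinuousAt (nfield ρ) z := by
  have hd : DifferentiableAt ℝ ρ z := hρ.differentiableAt (by simp)
  have hpos := gradNorm_pos hd h
  rw [gradNorm_eq hd] at hpos
  refine continuousAt_pi.2 fun j => ?_
  have hbar : ContinuousAt (fun w => dzbar j (cplx ρ) w) z :=
    (contDiffAt_dzbar (k := 0) (contDiffAt_cplx hρ) (by norm_num) j).continuousAt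
  have hsum : ContinuousAt (fun w => Real.sqrt (∑ k, normSq (dz k (cplx ρ) w))) z := by
    refine (tendsto_finsetSum _ fun k _ => ?_).sqrt
    exact Complex.continuous_normSq.continuousAt.comp (continuousAt_dz_cplx hρ k)
  refine ContinuousAt.mul (ContinuousAt.inv₀ ?_ ?_) hbar
  · exact Complex.continuous_ofReal.continuousAt.comp hsum
  · simpa using (by linarith : 0 < Real.sqrt (∑ k, normSq (dz k (cplx ρ) z))).ne'

lemma contDiffAt_levi_coeff {m k : WithTop ℕ∞} (hρ : ContDiffAt ℝ m ρ z) (hk : k + 2 ≤ m)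
    (i j : Fin n) : ContDiffAt ℝ k (fun w => dz i (fun w => dzbar j (cplx ρ) w) w) z :=
  contDiffAt_dz (contDiffAt_dzbar (k := k + 1) (contDiffAt_cplx hρ)
    (by rwa [add_assoc, one_add_one_eq_two]) j) le_rfl i

lemma continuousAt_levi {X Y : (Fin n → ℂ) → (Fin n → ℂ)} (hρ : ContDiffAt ℝ 2 ρ z)
    (hX : ContinuousAt X z) (hY : ContinuousAt Y z) :
    ContinuousAt (fun w => levi ρ (X w) (Y w) w) z := by
  have hc (i j : Fin n) := (contDiffAt_levi_coeff (k := 0) hρ (by norm_num) i j).continuousAt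
  refine tendsto_finsetSum _ fun i _ => tendsto_finsetSum _ fun j _ => ?_
  exact ((hc i j).mul (continuousAt_pi.1 hX i)).mul
    (Complex.continuous_conj.continuousAt.comp (continuousAt_pi.1 hY j))

lemma differentiableAt_levi {X Y : (Fin n → ℂ) → (Fin n → ℂ)} (hρ : ContDiffAt ℝ 3 ρ z)
    (hX : DifferentiableAt ℝ X z) (hY : DifferentiableAt ℝ Y z) :
    DifferentiableAt ℝ (fun w => levi ρ (X w) (Y w) w) z := by
  have hc (i j : Fin n) :=
    (contDiffAt_levi_coeff (k := 1) hρ (by norm_num) i j).differentiableAt (by simp)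
  have hconj (j : Fin n) : DifferentiableAt ℝ (fun w => (starRingEnd ℂ) (Y w j)) z :=
    Complex.conjCLE.differentiableAt.comp z (differentiableAt_pi.1 hY j)
  unfold levi
  fun_prop

lemma tendsto_slope_line {u : (Fin n → ℂ) → ℝ} (hu : DifferentiableAt ℝ u z) (h0 : u z = 0)
    (v : Fin n → ℂ) :
    Filter.Tendsto (fun t : ℝ => t⁻¹ * u (z + t • v)) (𝓝[>] 0) (𝓝 (fderiv ℝ u z v)) := by
  have h := (hu.hasFDerivAt.hasLineDerivAt v).tendsto_slope_zero_right
  simpa [h0] using h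

end Wirtinger

lemma IsDefFn.eq_zero_of_mem_frontier {n : ℕ} {Ω V : Set (Fin n → ℂ)} {ρ : (Fin n → ℂ) → ℝ}
    (hdef : IsDefFn Ω V ρ) (hΩ : IsOpen Ω) {p : Fin n → ℂ} (hp : p ∈ frontier Ω) : ρ p = 0 := by
  have hcl := frontier_subset_closure hp
  have hpV := hdef.subset hcl
  have hnot : p ∉ Ω := fun h => (hΩ.frontier_eq ▸ hp).2 h
  refine le_antisymm ?_ ?_
  · by_contra! h
    have hc := hdef.smooth.continuousOn.continuousAt (hdef.isOpen.mem_nhds hpV)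
    obtain ⟨w, hw, hwΩ⟩ := mem_closure_iff_nhds.1 hcl _ (hc.eventually (lt_mem_nhds h))
    rw [hdef.eq] at hwΩ
    exact lt_asymm hw hwΩ.2
  · by_contra! h
    exact hnot (hdef.eq ▸ ⟨hpV, h⟩)

lemma IsDefFn.notMem_closure {n : ℕ} {Ω V : Set (Fin n → ℂ)} {ρ : (Fin n → ℂ) → ℝ}
    (hdef : IsDefFn Ω V ρ) {z : Fin n → ℂ} (hzV : z ∈ V) (hz : 0 < ρ z) : z ∉ closure Ω := by
  intro hcl
  have hc := hdef.smooth.continuousOn.continuousAt (hdef.isOpen.mem_nhds hzV)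
  obtain ⟨w, hw, hwΩ⟩ := mem_closure_iff_nhds.1 hcl _ (hc.eventually (lt_mem_nhds hz))
  rw [hdef.eq] at hwΩ
  exact lt_asymm hw hwΩ.2

/-- Lemma 3.2: if `L_{ρ^{η₂}}(aL+bN, aL+bN) > 0` for all `(a,b) ≠ (0,0)`
outside `cl Ω` near `p`, then the key differential inequality holds at `p`. -/
theorem lemma_S1 {n : ℕ} (hn : 2 ≤ n) (Ω V : Set (Fin n → ℂ)) (ρ : (Fin n → ℂ) → ℝ)
    (hΩ : IsOpen Ω) (hbd : Bornology.IsBounded Ω)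
    (hdef : IsDefFn Ω V ρ) (hpsc : ∀ q ∈ frontier Ω, LeviPseudoconvexAt ρ q)
    (p : Fin n → ℂ) (hp : p ∈ frontier Ω)
    (Up : Set (Fin n → ℂ)) (hUp : IsOpen Up) (hpUp : p ∈ Up)
    (L : (Fin n → ℂ) → (Fin n → ℂ)) (hL : IsTangentField ρ L Up)
    (hSig : levi ρ (L p) (L p) p = 0)
    (η₂ : ℝ) (hη : 1 < η₂)
    (hpos : ∀ z ∈ (closure Ω)ᶜ ∩ Up, ∀ a b : ℂ, ¬(a = 0 ∧ b = 0) →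
      0 < (levi (fun w => ρ w ^ η₂) (a • L z + b • nfield ρ z)
        (a • L z + b • nfield ρ z) z).re) :
    keyIneqAt ρ L η₂ p := by
  have hpV : p ∈ V := hdef.subset (frontier_subset_closure hp)
  have hsm (m : ℕ) {z : Fin n → ℂ} (hz : z ∈ V) : ContDiffAt ℝ m ρ z :=
    (hdef.smooth.contDiffAt (hdef.isOpen.mem_nhds hz)).of_le (by exact_mod_cast le_top)
  have hsm1 {z : Fin n → ℂ} (hz : z ∈ V) : DifferentiableAt ℝ ρ z :=
    (hsm 1 hz).differentiableAt (by simp)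
  have hρ0 : ρ p = 0 := hdef.eq_zero_of_mem_frontier hΩ hp
  have hLd : DifferentiableAt ℝ L p :=
    (hL.1.contDiffAt (hUp.mem_nhds hpUp)).differentiableAt (by simp)
  have hg : 0 < gradNorm ρ p := gradNorm_pos (hsm1 hpV) (hdef.grad_ne p hp)
  have hNc : ContinuousAt (nfield ρ) p := continuousAt_nfield (hsm 1 hpV) (hdef.grad_ne p hp)
  set u : (Fin n → ℂ) → ℝ := fun w => (levi ρ (L w) (L w) w).re with hu_def
  have hlev : (fun w => levi ρ (L w) (L w) w) =ᶠ[𝓝 p] cplx u := by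
    filter_upwards [hdef.isOpen.mem_nhds hpV] with w hw
    exact Complex.ext (by simp [cplx, u]) (by simp [cplx, levi_self_im (hsm 2 hw)])
  have hu : DifferentiableAt ℝ u p :=
    Complex.reCLM.differentiableAt.comp p (differentiableAt_levi (hsm 3 hpV) hLd hLd)
  have hu0 : u p = 0 := by simp [u, hSig]
  set D : ℝ := (fieldDeriv (nfield ρ) (fun w => levi ρ (L w) (L w) w) p).re with hD
  set g : ℝ := gradNorm ρ p with hg_def
  set B : ℂ := levi ρ (L p) (nfield ρ p) p with hB
  have huN : fderiv ℝ u p (nfield ρ p) = 2 * D := by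
    rw [fderiv_eq_two_mul_re_dirDeriv hu, hD]
    simp only [fieldDeriv, dirDeriv, dz_congr hlev]
  have hρN : fderiv ℝ ρ p (nfield ρ p) = g := by
    rw [fderiv_eq_two_mul_re_dirDeriv (hsm1 hpV), dirDeriv_nfield (hsm1 hpV), Complex.ofReal_re]
    ring
  have hline : Filter.Tendsto (fun t : ℝ => p + t • nfield ρ p) (𝓝[>] 0) (𝓝 p) := by
    have : Continuous fun t : ℝ => p + t • nfield ρ p := by fun_prop
    simpa using (this.tendsto 0).mono_left nhdsWithin_le_nhds
  have hρslope := tendsto_slope_line (hsm1 hpV) hρ0 (nfield ρ p)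
  have huslope := tendsto_slope_line hu hu0 (nfield ρ p)
  rw [hρN] at hρslope
  rw [huN] at huslope
  have hmain (c : ℂ) :
      0 ≤ 2 * D + g * (2 * ((starRingEnd ℂ) c * B).re + normSq c * ((η₂ - 1) * (g / 2) ^ 2)) := by
    set h : (Fin n → ℂ) → ℝ := fun z =>
      2 * ((starRingEnd ℂ) c * levi ρ (L z) (nfield ρ z) z).re +
        normSq c * (ρ z * (levi ρ (nfield ρ z) (nfield ρ z) z).re +
          (η₂ - 1) * (gradNorm ρ z / 2) ^ 2) with hh
    have hhc : ContinuousAt h p := by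
      have h1 := continuousAt_levi (hsm 2 hpV) hLd.continuousAt hNc
      have h2 := continuousAt_levi (hsm 2 hpV) hNc hNc
      have h3 := continuousAt_gradNorm (hsm 1 hpV)
      have h4 := (hsm1 hpV).continuousAt
      have h5 := Complex.continuous_re.continuousAt.comp (continuousAt_const.mul h1 :
        ContinuousAt (fun z => (starRingEnd ℂ) c * levi ρ (L z) (nfield ρ z) z) p)
      have h6 := Complex.continuous_re.continuousAt.comp h2
      simp only [Function.comp_def] at h5 h6
      fun_prop
    have hhp : h p = 2 * ((starRingEnd ℂ) c * B).re + normSq c * ((η₂ - 1) * (g / 2) ^ 2) := by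
      simp [h, hρ0, hB, hg_def]
    rw [← hhp]
    refine ge_of_tendsto (huslope.add (hρslope.mul (hhc.tendsto.comp hline))) ?_
    filter_upwards [self_mem_nhdsWithin, hρslope.eventually (lt_mem_nhds hg),
      hline.eventually (hdef.isOpen.mem_nhds hpV), hline.eventually (hUp.mem_nhds hpUp)]
      with t ht hρt hV hU
    have ht' : 0 < t⁻¹ := inv_pos.2 ht
    simp only [Function.comp_apply]
    set z := p + t • nfield ρ p
    have hρz : 0 < ρ z := pos_of_mul_pos_right hρt ht'.le
    have hP := hpos z ⟨hdef.notMem_closure hV hρz, hU⟩ 1 (ρ z * c) (by simp)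
    rw [one_smul, levi_rpow (hsm 2 hV) hρz, Complex.re_ofReal_mul, dirDeriv_add, dirDeriv_smul,
      hL.2 z hU, dirDeriv_nfield (hsm1 hV), Complex.add_re, re_levi_add_smul (hsm 2 hV)] at hP
    have hP' := pos_of_mul_pos_right hP
      (mul_pos (by linarith) (Real.rpow_pos_of_pos hρz _)).le
    rw [← Complex.ofReal_mul, Complex.ofReal_re] at hP'
    have heq : t⁻¹ * u z + t⁻¹ * ρ z * h z = t⁻¹ * (u z + ρ z * h z) := by ring
    rw [heq]
    refine (mul_pos ht' (hP'.trans_eq ?_)).le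
    simp only [u, h, map_mul, zero_add, Complex.normSq_ofReal, Complex.conj_ofReal, mul_assoc,
      Complex.re_ofReal_mul]
    field_simp
    ring
  have hη' : 0 < η₂ - 1 := by linarith
  have hc := hmain ((-(4 / ((η₂ - 1) * g ^ 2)) : ℝ) * B)
  have hBB : ((starRingEnd ℂ) B * B).re = normSq B := by
    rw [← Complex.normSq_eq_conj_mul_self, Complex.ofReal_re]
  rw [map_mul, map_mul, Complex.conj_ofReal, mul_assoc, Complex.re_ofReal_mul, hBB,
    Complex.normSq_ofReal] at hc
  have hkey : 1 / (η₂ - 1) * normSq B / g ^ 2 - 1 / 2 * D / g =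
      -(1 / (4 * g)) * (2 * D + g * (2 * (-(4 / ((η₂ - 1) * g ^ 2)) * normSq B) +
        -(4 / ((η₂ - 1) * g ^ 2)) * -(4 / ((η₂ - 1) * g ^ 2)) * normSq B *
          ((η₂ - 1) * (g / 2) ^ 2))) := by
    field_simp
    ring
  change 1 / (η₂ - 1) * normSq B / g ^ 2 - 1 / 2 * D / g ≤ 0
  rw [hkey]
  exact mul_nonpos_of_nonpos_of_nonneg (by simpa using hg.le) hc
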